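/- Let N ≥ 1 and K ≤ N be natural numbers and set T = ⌈log₂ (N choose K)⌉ + K. There exist an adaptive group testing strategy f with T tests on Fin N and a decoder g : (Fin T → Bool) → Finset (Fin N) such that for every subset D : Finset (Fin N) with D.card = K, g (a(D)) = D. (Theorem 2.3, Hwang's Generalized Binary Splitting Algorithm: adaptive group testing with K defectives among N items is guaranteed to succeed using log₂ binom(N,K) + K tests.) -/

import Mathlib

/-- The answer sequence of an adaptive group testing strategy `f` on defective set `D`:
the `i`-th answer is `true` iff the `i`-th test set (which may depend on the earlier
answers) intersects `D`. -/
def answers {N T : ℕ} (f : (i : Fin T) → ((j : Fin T) → j < i → Bool) → Finset (Fin N))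
    (D : Finset (Fin N)) : Fin T → Bool
  | i => decide (D ∩ f i (fun j hj => answers f D j)).Nonempty
termination_by i => i.val
decreasing_by all_goals assumption

/-- A family `F` of candidate defective sets is solvable with `T` tests if some binary decision
tree of depth `T`, whose nodes are group tests, separates its members. -/
def Solvable {α : Type*} : ℕ → Set (Finset α) → Prop
  | 0, F => F.Subsingleton
  | T + 1, F => ∃ S : Finset α,
      Solvable T {D ∈ F | ¬ Disjoint D S} ∧ Solvable T {D ∈ F | Disjoint D S}

namespace Solvable

variable {α : Type*} {T T' : ℕ} {F G : Set (Finset α)}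

theorem subset (hF : Solvable T F) (hGF : G ⊆ F) : Solvable T G := by
  induction T generalizing F G with
  | zero => exact Set.Subsingleton.anti hF hGF
  | succ T ih =>
    obtain ⟨S, h₁, h₂⟩ := hF
    exact ⟨S, ih h₁ fun D hD => ⟨hGF hD.1, hD.2⟩, ih h₂ fun D hD => ⟨hGF hD.1, hD.2⟩⟩

theorem mono (hF : Solvable T F) (hT : T ≤ T') : Solvable T' F := by
  induction hT with
  | refl => exact hF
  | step _ ih => exact ⟨∅, ih.subset fun D hD => hD.1, ih.subset fun D hD => hD.1⟩

theorem of_subsingleton (hF : F.Subsingleton) : Solvable T F :=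
  mono (T := 0) hF (Nat.zero_le T)

end Solvable

theorem answers_apply {N T : ℕ} (f : (i : Fin T) → ((j : Fin T) → j < i → Bool) → Finset (Fin N))
    (D : Finset (Fin N)) (i : Fin T) :
    answers f D i = decide (D ∩ f i (fun j _ => answers f D j)).Nonempty := by
  rw [answers]

/-- The strategy that first tests `S` and then follows `f b`, where `b` is the first answer. -/
def consStrategy {N T : ℕ} (S : Finset (Fin N))
    (f : Bool → (i : Fin T) → ((j : Fin T) → j < i → Bool) → Finset (Fin N)) :
    (i : Fin (T + 1)) → ((j : Fin (T + 1)) → j < i → Bool) → Finset (Fin N) :=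
  Fin.cases (fun _ => S) fun i h =>
    f (h 0 i.succ_pos) i fun j hj => h j.succ (Fin.succ_lt_succ_iff.mpr hj)

theorem answers_consStrategy_zero {N T : ℕ} (S : Finset (Fin N))
    (f : Bool → (i : Fin T) → ((j : Fin T) → j < i → Bool) → Finset (Fin N))
    (D : Finset (Fin N)) :
    answers (consStrategy S f) D 0 = decide (D ∩ S).Nonempty := by
  rw [answers_apply]; rfl

theorem answers_consStrategy_succ {N T : ℕ} (S : Finset (Fin N))
    (f : Bool → (i : Fin T) → ((j : Fin T) → j < i → Bool) → Finset (Fin N))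
    (D : Finset (Fin N)) (i : Fin T) :
    answers (consStrategy S f) D i.succ = answers (f (decide (D ∩ S).Nonempty)) D i := by
  induction i using WellFoundedLT.induction with
  | ind i ih =>
    rw [answers_apply, answers_apply (f _)]
    have h : (fun (j : Fin T) (_ : j < i) => answers (consStrategy S f) D j.succ) =
        fun j _ => answers (f (decide (D ∩ S).Nonempty)) D j := by
      funext j hj
      exact ih j hj
    rw [← h, ← answers_consStrategy_zero S f D]
    rfl

theorem Solvable.exists_strategy {N T : ℕ} {F : Set (Finset (Fin N))} (hF : Solvable T F) :
    ∃ (f : (i : Fin T) → ((j : Fin T) → j < i → Bool) → Finset (Fin N))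
      (g : (Fin T → Bool) → Finset (Fin N)), ∀ D ∈ F, g (answers f D) = D := by
  induction T generalizing F with
  | zero =>
    rcases F.eq_empty_or_nonempty with rfl | ⟨D₀, hD₀⟩
    · exact ⟨fun _ _ => ∅, fun _ => ∅, by simp⟩
    · exact ⟨fun _ _ => ∅, fun _ => D₀, fun D hD => hF hD₀ hD⟩
  | succ T ih =>
    obtain ⟨S, h₁, h₂⟩ := hF
    obtain ⟨f₁, g₁, hg₁⟩ := ih h₁
    obtain ⟨f₂, g₂, hg₂⟩ := ih h₂
    let f : Bool → (i : Fin T) → ((j : Fin T) → j < i → Bool) → Finset (Fin N) :=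
      fun b => cond b f₁ f₂
    refine ⟨consStrategy S f, fun a => (cond (a 0) g₁ g₂) fun i => a i.succ, fun D hD => ?_⟩
    simp only [answers_consStrategy_zero, answers_consStrategy_succ]
    by_cases h : Disjoint D S
    · have h' : decide (D ∩ S).Nonempty = false := by
        simpa [Finset.disjoint_iff_inter_eq_empty] using h
      rw [h']
      exact hg₂ D ⟨hD, h⟩
    · have h' : decide (D ∩ S).Nonempty = true := by
        simpa [Finset.disjoint_iff_inter_eq_empty, Finset.nonempty_iff_ne_empty] using h
      rw [h']
      exact hg₁ D ⟨hD, h⟩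

/-- An interval of powers of two with nonincreasing exponents and total at most `2 ^ (T + 1)`
can be cut into two intervals of total at most `2 ^ T` each. -/
theorem exists_split_sum_two_pow {e : ℕ → ℕ} (he : Antitone e) {a b T : ℕ} (hab : a ≤ b)
    (heT : ∀ j ∈ Finset.Ico a b, e j ≤ T)
    (hsum : ∑ j ∈ Finset.Ico a b, 2 ^ e j ≤ 2 ^ (T + 1)) :
    ∃ c, a ≤ c ∧ c ≤ b ∧ ∑ j ∈ Finset.Ico a c, 2 ^ e j ≤ 2 ^ T ∧
      ∑ j ∈ Finset.Ico c b, 2 ^ e j ≤ 2 ^ T := by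
  let P : ℕ → Prop := fun c => ∑ j ∈ Finset.Ico a c, 2 ^ e j ≤ 2 ^ T
  have hPa : P a := by simp [P]
  have hac : a ≤ Nat.findGreatest P b := Nat.le_findGreatest hab hPa
  have hcb : Nat.findGreatest P b ≤ b := Nat.findGreatest_le b
  have hPc : P (Nat.findGreatest P b) := Nat.findGreatest_spec hab hPa
  have hmax : ∀ k, Nat.findGreatest P b < k → k ≤ b → ¬ P k :=
    fun k => Nat.findGreatest_is_greatest
  generalize Nat.findGreatest P b = c at hac hcb hPc hmax
  refine ⟨c, hac, hcb, hPc, ?_⟩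
  rcases hcb.eq_or_lt with rfl | hlt
  · simp
  have hnext := hmax (c + 1) (Nat.lt_succ_self c) hlt
  simp only [P, Finset.sum_Ico_succ_top hac] at hPc hnext
  have hdvd : 2 ^ e c ∣ ∑ j ∈ Finset.Ico a c, 2 ^ e j :=
    Finset.dvd_sum fun j hj => pow_dvd_pow 2 (he (Finset.mem_Ico.mp hj).2.le)
  have hdvd' : 2 ^ e c ∣ 2 ^ T := pow_dvd_pow 2 (heT c (Finset.mem_Ico.mpr ⟨hac, hlt⟩))
  have heq : ∑ j ∈ Finset.Ico a c, 2 ^ e j = 2 ^ T := by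
    by_contra hne
    have hpos : 0 < 2 ^ T - ∑ j ∈ Finset.Ico a c, 2 ^ e j := by omega
    have := Nat.le_of_dvd hpos (Nat.dvd_sub hdvd' hdvd)
    omega
  have := Finset.sum_Ico_consecutive (fun j => 2 ^ e j) hac hcb
  rw [pow_succ] at hsum
  omega

/-- Locating the first index `j` at which `D` meets `P (j + 1)`, followed by `e j` further
tests, can be done within `T` tests in total as soon as the Kraft-type inequality
`∑ j, 2 ^ e j ≤ 2 ^ T` holds and the exponents are nonincreasing. -/
theorem Solvable.of_sum_two_pow_le {α : Type*} {F : Set (Finset α)} (P : ℕ → Finset α)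
    {e : ℕ → ℕ} (he : Antitone e) {a b T : ℕ} (hab : a ≤ b)
    (hF : ∀ j ∈ Finset.Ico a b,
      Solvable (e j) {D ∈ F | Disjoint D (P j) ∧ ¬ Disjoint D (P (j + 1))})
    (hsum : ∑ j ∈ Finset.Ico a b, 2 ^ e j ≤ 2 ^ T) :
    Solvable T {D ∈ F | Disjoint D (P a) ∧ ¬ Disjoint D (P b)} := by
  induction T generalizing a b with
  | zero =>
    have hcard : (Finset.Ico a b).card ≤ 1 := by
      rw [Finset.card_eq_sum_ones]
      exact (Finset.sum_le_sum fun j _ => Nat.one_le_two_pow).trans hsum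
    rw [Nat.card_Ico] at hcard
    obtain rfl | rfl : b = a ∨ b = a + 1 := by omega
    · exact of_subsingleton fun D hD => absurd hD.2.1 hD.2.2
    · refine (hF a (by simp)).mono ((Nat.pow_le_pow_iff_right (a := 2) (by norm_num)).mp ?_)
      simpa using hsum
  | succ T ih =>
    obtain rfl | rfl | hlt : b = a ∨ b = a + 1 ∨ a + 1 < b := by omega
    · exact of_subsingleton fun D hD => absurd hD.2.1 hD.2.2
    · refine (hF a (by simp)).mono ((Nat.pow_le_pow_iff_right (a := 2) (by norm_num)).mp ?_)
      simpa using hsum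
    · have hea : e a ≤ T := by
        have h : 2 ^ e a < ∑ j ∈ Finset.Ico a b, 2 ^ e j := by
          rw [Finset.sum_eq_sum_Ico_succ_bot (by omega), Finset.sum_eq_sum_Ico_succ_bot hlt]
          have := Nat.two_pow_pos (e (a + 1))
          omega
        exact Nat.lt_succ_iff.mp ((Nat.pow_lt_pow_iff_right (by norm_num)).mp (h.trans_le hsum))
      obtain ⟨c, hac, hcb, h₁, h₂⟩ := exists_split_sum_two_pow he hab
        (fun j hj => (he (Finset.mem_Ico.mp hj).1).trans hea) hsum
      refine ⟨P c, (ih hac (fun j hj => hF j ?_) h₁).subset ?_,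
        (ih hcb (fun j hj => hF j ?_) h₂).subset ?_⟩
      · simp only [Finset.mem_Ico] at hj ⊢; omega
      · exact fun D hD => ⟨hD.1.1, hD.1.2.1, hD.2⟩
      · simp only [Finset.mem_Ico] at hj ⊢; omega
      · exact fun D hD => ⟨hD.1.1, hD.2, hD.1.2.2⟩

theorem two_pow_clog_le {x : ℕ} (hx : 0 < x) : 2 ^ Nat.clog 2 x ≤ 2 * x := by
  obtain rfl | h : x = 1 ∨ 1 < x := by omega
  · simp
  · have hlt := Nat.pow_pred_clog_lt_self (b := 2) (by norm_num) h
    obtain ⟨m, hm⟩ : ∃ m, Nat.clog 2 x = m + 1 :=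
      ⟨_, (Nat.succ_pred_eq_of_pos (Nat.clog_pos (by norm_num) h)).symm⟩
    rw [hm] at hlt ⊢
    simp only [Nat.pred_succ] at hlt
    rw [pow_succ]
    omega

theorem sum_Ico_choose_add_choose (N K : ℕ) {s b : ℕ} (hsb : s ≤ b) (hbN : b ≤ N) :
    ∑ j ∈ Finset.Ico s b, (N - (j + 1)).choose K + (N - b).choose (K + 1) =
      (N - s).choose (K + 1) := by
  induction b, hsb using Nat.le_induction with
  | base => simp
  | succ b hsb ih =>
    rw [← ih (by omega), Finset.sum_Ico_succ_top hsb]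
    obtain ⟨m, rfl⟩ := Nat.exists_eq_add_of_le hbN
    have h₁ : b + 1 + m - (b + 1) = m := by omega
    have h₂ : b + 1 + m - b = m + 1 := by omega
    rw [h₁, h₂, Nat.choose_succ_succ']
    ring

theorem card_filter_le_val {N : ℕ} (D : Finset (Fin N)) (s : ℕ) :
    (D.filter fun i => s ≤ i.val).card ≤ N - s := by
  rw [← Nat.card_Ico, ← Finset.card_map Fin.valEmbedding]
  refine Finset.card_le_card fun i hi => ?_
  simp only [Finset.mem_map, Finset.mem_filter, Fin.valEmbedding_apply] at hi
  obtain ⟨x, hx, rfl⟩ := hi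
  exact Finset.mem_Ico.mpr ⟨hx.2, x.isLt⟩

/-- The defective sets whose elements below `s` are known to be `D₀` and which have `K` further
elements can be told apart with `T` tests whenever `2 ^ K * (N - s).choose K ≤ 2 ^ T`. -/
theorem solvable_of_two_pow_mul_choose_le {N K s T : ℕ} (D₀ : Finset (Fin N))
    (hT : 2 ^ K * (N - s).choose K ≤ 2 ^ T) :
    Solvable T {D : Finset (Fin N) | (D.filter fun i => i.val < s) = D₀ ∧
      (D.filter fun i => s ≤ i.val).card = K} := by
  induction K generalizing s T D₀ with
  | zero =>
    refine Solvable.of_subsingleton fun D hD E hE => ?_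
    have key : ∀ D' : Finset (Fin N), (D'.filter fun i => i.val < s) = D₀ ∧
        (D'.filter fun i => s ≤ i.val).card = 0 → D' = D₀ := by
      rintro D' ⟨rfl, h⟩
      rw [Finset.card_eq_zero, Finset.filter_eq_empty_iff] at h
      exact (Finset.filter_true_of_mem fun i hi => not_le.mp (h hi)).symm
    exact (key D hD).trans (key E hE).symm
  | succ K ih =>
    rcases le_or_gt (N - K) s with hs | hs
    · refine Solvable.of_subsingleton fun D hD => ?_
      have := hD.2 ▸ card_filter_le_val D s
      omega
    let P : ℕ → Finset (Fin N) := fun c => Finset.univ.filter fun i => s ≤ i.val ∧ i.val < c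
    let e : ℕ → ℕ := fun j => Nat.clog 2 (2 ^ K * (N - (j + 1)).choose K)
    have he : Antitone e := fun i j hij =>
      Nat.clog_mono_right 2 (Nat.mul_le_mul_left _ (Nat.choose_le_choose K (by omega)))
    refine (Solvable.of_sum_two_pow_le P he hs.le (fun j hj => ?_) ?_).subset
      fun D hD => ⟨hD, ?_, ?_⟩
    · rw [Finset.mem_Ico] at hj
      let x : Fin N := ⟨j, by omega⟩
      refine (ih (s := j + 1) (insert x D₀) (Nat.le_pow_clog (by norm_num) _)).subset ?_
      rintro D ⟨⟨rfl, hcard⟩, hdisj, hmeet⟩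
      simp only [P, Finset.disjoint_left, Finset.mem_filter, Finset.mem_univ, true_and] at hdisj
      have hx : x ∈ D := by
        simp only [P, Finset.not_disjoint_iff, Finset.mem_filter, Finset.mem_univ,
          true_and] at hmeet
        obtain ⟨i, hi, hsi, hij⟩ := hmeet
        have : i = x := Fin.ext (by have := hdisj hi; simp only [x]; omega)
        exact this ▸ hi
      refine ⟨?_, ?_⟩
      · ext i
        have := @hdisj i
        simp only [Finset.mem_filter, Finset.mem_insert, Fin.ext_iff, x]
        constructor
        · rintro ⟨hi, hij⟩
          have := this hi
          by_cases h : i.val = j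
          · exact Or.inl h
          · exact Or.inr ⟨hi, by omega⟩
        · rintro (h | ⟨hi, hlt⟩)
          · exact ⟨(Fin.ext h : i = x) ▸ hx, by omega⟩
          · exact ⟨hi, by omega⟩
      · have heq : (D.filter fun i => s ≤ i.val) =
            insert x (D.filter fun i => j + 1 ≤ i.val) := by
          ext i
          have := @hdisj i
          simp only [Finset.mem_filter, Finset.mem_insert, Fin.ext_iff, x]
          constructor
          · rintro ⟨hi, hsi⟩
            have := this hi
            by_cases h : i.val = j
            · exact Or.inl h
            · exact Or.inr ⟨hi, by omega⟩
          · rintro (h | ⟨hi, hlt⟩)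
            · exact ⟨(Fin.ext h : i = x) ▸ hx, by omega⟩
            · exact ⟨hi, by omega⟩
        rw [heq, Finset.card_insert_of_notMem (by simp [x])] at hcard
        omega
    · calc ∑ j ∈ Finset.Ico s (N - K), 2 ^ e j
          ≤ ∑ j ∈ Finset.Ico s (N - K), 2 ^ (K + 1) * (N - (j + 1)).choose K := by
            refine Finset.sum_le_sum fun j hj => ?_
            rw [Finset.mem_Ico] at hj
            have hpos : 0 < (N - (j + 1)).choose K := Nat.choose_pos (by omega)
            refine (two_pow_clog_le (by positivity)).trans_eq ?_
            ring
        _ ≤ 2 ^ (K + 1) * (N - s).choose (K + 1) := by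
            rw [← Finset.mul_sum]
            refine Nat.mul_le_mul_left _ ?_
            rw [← sum_Ico_choose_add_choose N K hs.le (Nat.sub_le N K)]
            exact Nat.le_add_right _ _
        _ ≤ 2 ^ T := hT
    · simp only [P, Finset.disjoint_left, Finset.mem_filter]
      rintro i - ⟨-, h₁, h₂⟩
      omega
    · intro hdisj
      have hle : (D.filter fun i => s ≤ i.val) ⊆ D.filter fun i => N - K ≤ i.val := by
        intro i hi
        rw [Finset.mem_filter] at hi ⊢
        refine ⟨hi.1, not_lt.mp fun hlt => ?_⟩
        exact Finset.disjoint_left.mp hdisj hi.1 (by simp [P, hi.2, hlt])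
      have h₁ := Finset.card_le_card hle
      have h₂ := card_filter_le_val D (N - K)
      have h₃ := hD.2
      omega

/-- Theorem 2.3 (Hwang's Generalized Binary Splitting Algorithm): adaptive group testing
with `K` defectives among `N` items is guaranteed to succeed using
`⌈log₂ (N choose K)⌉ + K` tests. -/
theorem hwang_generalized_binary_splitting (N K : ℕ) (hN : 1 ≤ N) (hKN : K ≤ N) :
    ∃ (f : (i : Fin (Nat.clog 2 (N.choose K) + K)) →
          ((j : Fin (Nat.clog 2 (N.choose K) + K)) → j < i → Bool) → Finset (Fin N))
      (g : (Fin (Nat.clog 2 (N.choose K) + K) → Bool) → Finset (Fin N)),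
      ∀ D : Finset (Fin N), D.card = K → g (answers f D) = D := by
  refine (Solvable.exists_strategy ((solvable_of_two_pow_mul_choose_le (K := K) (s := 0) ∅
    ?_).subset (G := {D : Finset (Fin N) | D.card = K}) fun D hD => ?_))
  · rw [Nat.sub_zero, pow_add, mul_comm]
    exact Nat.mul_le_mul_right _ (Nat.le_pow_clog (by norm_num) _)
  · simpa using hD
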